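/- There exist no reals b, c such that, setting a = (1 − 3b − 3c)/3 and λ = (a, a, a, b, b, b, c, c, c), one has a > b > c > 0, l₂(λ) = 0, and L₁(λ) positive semidefinite. -/

import Mathlib

noncomputable section

/-- The matrix `L₁(x)` for a vector `x = (x₁,…,x₉)` (indexed as `x 0, …, x 8`). -/
def L1m (x : Fin 9 → ℝ) : Matrix (Fin 3) (Fin 3) ℝ :=
  !![2 * x 8, x 7 - x 0, x 5 - x 1;
     x 7 - x 0, 2 * x 6, x 4 - x 2;
     x 5 - x 1, x 4 - x 2, 2 * x 3]

/-- The matrix `L₂(x)` for a vector `x = (x₁,…,x₉)` (indexed as `x 0, …, x 8`). -/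
def L2m (x : Fin 9 → ℝ) : Matrix (Fin 3) (Fin 3) ℝ :=
  !![2 * x 8, x 7 - x 0, x 6 - x 1;
     x 7 - x 0, 2 * x 5, x 4 - x 2;
     x 6 - x 1, x 4 - x 2, 2 * x 3]

/-- `l₁(x) = det L₁(x)`. -/
def l1 (x : Fin 9 → ℝ) : ℝ := (L1m x).det

/-- `l₂(x) = det L₂(x)`. -/
def l2 (x : Fin 9 → ℝ) : ℝ := (L2m x).det

/-- The determinant of `L₂(a, a, a, b, b, b, c, c, c)` factors along the eigenvector
`(0, 1, -1)`. -/
theorem l2_triple (a b c : ℝ) :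
    l2 ![a, a, a, b, b, b, c, c, c] = 2 * (a + b) * (c * (3 * b - a) - (a - c) ^ 2) := by
  simp [l2, L2m, Matrix.det_fin_three]
  ring

/-- Evaluating the quadratic form of `L₁(a, a, a, b, b, b, c, c, c)` at `(b, b, a - b)`. -/
theorem sq_le_of_posSemidef_L1m_triple {a b c : ℝ} (hb : 0 < b)
    (h : (L1m ![a, a, a, b, b, b, c, c, c]).PosSemidef) :
    (a - b) ^ 2 ≤ b * (3 * c - a) := by
  have h0 := h.dotProduct_mulVec_nonneg ![b, b, a - b]
  simp [L1m, Matrix.mulVec, dotProduct, Fin.sum_univ_three] at h0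
  have h1 : 0 ≤ 2 * b * (b * (3 * c - a) - (a - b) ^ 2) := by linarith
  linarith [nonneg_of_mul_nonneg_right h1 (by positivity)]

/-- there are no reals b, c with a = (1 − 3b − 3c)/3 > b > c > 0 such that
l₂(a, a, a, b, b, b, c, c, c) = 0 and L₁(a, a, a, b, b, b, c, c, c) is positive
semidefinite. -/
theorem no_nu333_l2_zero :
    ¬ ∃ b c : ℝ, b < (1 - 3 * b - 3 * c) / 3 ∧ c < b ∧ 0 < c ∧
      l2 ![(1 - 3 * b - 3 * c) / 3, (1 - 3 * b - 3 * c) / 3, (1 - 3 * b - 3 * c) / 3,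
          b, b, b, c, c, c] = 0 ∧
      (L1m ![(1 - 3 * b - 3 * c) / 3, (1 - 3 * b - 3 * c) / 3, (1 - 3 * b - 3 * c) / 3,
          b, b, b, c, c, c]).PosSemidef := by
  rintro ⟨b, c, hab, hbc, hc, hl, hL⟩
  generalize (1 - 3 * b - 3 * c) / 3 = a at *
  have hq := sq_le_of_posSemidef_L1m_triple (hc.trans hbc) hL
  rw [l2_triple] at hl
  have hl' : c * (3 * b - a) - (a - c) ^ 2 = 0 :=
    (mul_eq_zero.mp hl).resolve_left (by linarith)
  have hle : c ≤ a - b := by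
    have hd : 0 ≤ (b - c) * (a - b - c) := by linarith
    linarith [nonneg_of_mul_nonneg_right hd (sub_pos.mpr hbc)]
  nlinarith [mul_nonneg (sub_nonneg.mpr hbc.le) (sub_nonneg.mpr hle),
    mul_nonneg hc.le (sub_nonneg.mpr hle), pow_pos (sub_pos.mpr hbc) 2]
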